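/- For symmetric d×d real matrices A_1,...,A_n and any pair partition ν of [2p], the sum over all functions u:[2p]→[n] compatible with ν of tr(A_{u(1)}···A_{u(2p)}) is at most tr((Σ_{k=1}^n A_k²)^p). -/

import Mathlib

open Matrix


namespace Buch

lemma trace_cs {d : ℕ} (X Y : Matrix (Fin d) (Fin d) ℝ) :
    2 * trace (X * Y) ≤ trace (X * Xᵀ) + trace (Y * Yᵀ) := by
  have h : 0 ≤ trace ((X - Yᵀ) * (X - Yᵀ)ᵀ) := by
    simp only [trace, diag, mul_apply, transpose_apply]
    exact Finset.sum_nonneg fun i _ => Finset.sum_nonneg fun j _ => mul_self_nonneg _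
  have h1 : trace (X * Y) = trace (Yᵀ * Xᵀ) := by
    rw [← transpose_mul, trace_transpose]
  have h2 : trace (Yᵀ * Y) = trace (Y * Yᵀ) := trace_mul_comm _ _
  simp only [transpose_sub, transpose_transpose, sub_mul, mul_sub, trace_sub] at h
  linarith

lemma sum_fiber {d : ℕ} {α β W : Type*} [Fintype α] [Fintype β] [Fintype W] [DecidableEq W]
    (f : α → Matrix (Fin d) (Fin d) ℝ) (g : β → Matrix (Fin d) (Fin d) ℝ)
    (Φ : α → W) (Ψ : β → W) :
    ∑ w, trace ((∑ a, if Φ a = w then f a else 0) * (∑ b, if Ψ b = w then g b else 0)) =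
      ∑ a, ∑ b, if Φ a = Ψ b then trace (f a * g b) else 0 := by
  simp only [Finset.sum_mul, Finset.mul_sum, trace_sum]
  have sc : ∀ G : W → β → α → ℝ, ∑ w, ∑ b, ∑ a, G w b a = ∑ a, ∑ b, ∑ w, G w b a := by
    intro G
    calc _ = ∑ w, ∑ a, ∑ b, G w b a := Finset.sum_congr rfl fun w _ => Finset.sum_comm
      _ = ∑ a, ∑ w, ∑ b, G w b a := Finset.sum_comm
      _ = _ := Finset.sum_congr rfl fun a _ => Finset.sum_comm
  rw [sc]
  refine Finset.sum_congr rfl fun a _ => ?_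
  refine Finset.sum_congr rfl fun b _ => ?_
  rw [Finset.sum_eq_single (Φ a)]
  · by_cases h : Φ a = Ψ b
    · simp [h]
    · simp [h, Ne.symm h]
  · intro w _ hw
    simp [Ne.symm hw]
  · simp

lemma abstract_cs {d : ℕ} {α β W : Type*} [Fintype α] [Fintype β] [Fintype W] [DecidableEq W]
    (f : α → Matrix (Fin d) (Fin d) ℝ) (g : β → Matrix (Fin d) (Fin d) ℝ)
    (Φ : α → W) (Ψ : β → W) :
    2 * (∑ a, ∑ b, if Φ a = Ψ b then trace (f a * g b) else 0) ≤
      (∑ a, ∑ a', if Φ a = Φ a' then trace (f a * (f a')ᵀ) else 0) +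
      (∑ b, ∑ b', if Ψ b = Ψ b' then trace (g b * (g b')ᵀ) else 0) := by
  rw [← sum_fiber f g, ← sum_fiber f (fun a => (f a)ᵀ), ← sum_fiber g (fun a => (g a)ᵀ),
    Finset.mul_sum, ← Finset.sum_add_distrib]
  refine Finset.sum_le_sum fun w _ => ?_
  refine (trace_cs _ _).trans (le_of_eq ?_)
  simp only [transpose_sum, apply_ite transpose, transpose_zero]

/-- the pairing sum -/
noncomputable def F {d n N : ℕ} (A : Fin n → Matrix (Fin d) (Fin d) ℝ) (π : Fin N → Fin N) : ℝ :=
  ∑ u : Fin N → Fin n, if (∀ i, u (π i) = u i) then trace (List.ofFn (fun i => A (u i))).prod else 0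

def P {N : ℕ} (π : Fin N → Fin N) : Prop := ∀ i, π (π i) = i ∧ π i ≠ i

lemma trace_rotate {d : ℕ} (l : List (Matrix (Fin d) (Fin d) ℝ)) (k : ℕ) (hk : k ≤ l.length) :
    trace (l.rotate k).prod = trace l.prod := by
  rw [List.rotate_eq_drop_append_take hk, List.prod_append, trace_mul_comm, ← List.prod_append,
    List.take_append_drop]

lemma ofFn_rotate {α : Type*} {N : ℕ} (f : Fin N → α) (c : Fin N) :
    List.ofFn (fun i => f (i + c)) = (List.ofFn f).rotate c := by
  apply List.ext_getElem
  · simp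
  · intro k h1 h2
    simp [List.getElem_rotate, Fin.add_def]

def rot {N : ℕ} [NeZero N] (c : Fin N) (π : Fin N → Fin N) : Fin N → Fin N := fun i => π (i - c) + c

lemma F_rot {d n N : ℕ} [NeZero N] (A : Fin n → Matrix (Fin d) (Fin d) ℝ) (c : Fin N)
    (π : Fin N → Fin N) : F A (rot c π) = F A π := by
  unfold F
  refine Fintype.sum_equiv ((Equiv.addRight c).symm.arrowCongr (Equiv.refl _)) _ _ fun u => ?_
  have h1 : (∀ i, u (rot c π i) = u i) ↔ ∀ i, u (π i + c) = u (i + c) := by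
    constructor
    · intro h i
      have := h (i + c)
      simpa [rot] using this
    · intro h i
      have := h (i - c)
      simpa [rot] using this
  have h2 : trace (List.ofFn (fun i => A (u i))).prod =
      trace (List.ofFn (fun i => A (u (i + c)))).prod := by
    rw [ofFn_rotate (fun i => A (u i)) c, trace_rotate]
    simpa using c.2.le
  simp only [h1, h2]
  rfl

lemma P_rot {N : ℕ} [NeZero N] (c : Fin N) (π : Fin N → Fin N) (h : P π) : P (rot c π) := by
  intro i
  constructor
  · simp [rot, (h _).1]
  · intro h'
    apply (h (i - c)).2
    rw [eq_sub_iff_add_eq]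
    exact h'

/-- reflection of the left half -/
def L {p : ℕ} (π : Fin (p + p) → Fin (p + p)) : Fin (p + p) → Fin (p + p) := fun i =>
  if i.val < p then (if (π i).val < p then π i else i.rev)
  else (if (π i.rev).val < p then (π i.rev).rev else i.rev)

def Sw {p : ℕ} (π : Fin (p + p) → Fin (p + p)) : Fin (p + p) → Fin (p + p) := fun i =>
  finAddFlip (π (finAddFlip i))

lemma P_L {p : ℕ} (π : Fin (p + p) → Fin (p + p)) (h : P π) : P (L π) := by
  intro i
  have h1 := h i
  have h2 := h i.rev
  have hr : i.rev.val = p + p - 1 - i := by rw [Fin.val_rev]; omega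
  have e1 : (π i).rev.val = p + p - 1 - (π i) := by rw [Fin.val_rev]; omega
  have e2 : (π i.rev).rev.val = p + p - 1 - (π i.rev) := by rw [Fin.val_rev]; omega
  unfold L
  constructor
  · by_cases a : i.val < p
    · by_cases b : (π i).val < p
      · simp [a, b, h1]
      · have : ¬ (i.rev).val < p := by omega
        simp only [a, b, this, if_true, if_false, Fin.rev_rev]
    · by_cases b : (π i.rev).val < p
      · have : ¬ ((π i.rev).rev).val < p := by omega
        simp only [a, b, this, if_true, if_false, Fin.rev_rev, h2.1,
          (show (i.rev).val < p by omega)]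
      · simp only [a, b, if_true, if_false, Fin.rev_rev, (show (i.rev).val < p by omega)]
  · have h3 : (π i).val ≠ i.val := fun h => h1.2 (Fin.ext h)
    have h4 : (π i.rev).val ≠ i.rev.val := fun h => h2.2 (Fin.ext h)
    intro h5
    have h6 := congrArg Fin.val h5
    clear h1 h2 h5
    split_ifs at h6 <;> omega

lemma P_Sw {p : ℕ} (π : Fin (p + p) → Fin (p + p)) (h : P π) : P (Sw π) := by
  have hf : ∀ i : Fin (p + p), finAddFlip (finAddFlip i) = i := by
    intro i
    refine Fin.addCases (fun i => ?_) (fun i => ?_) i <;> simp [-Fin.natAdd_eq_addNat]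
  intro i
  constructor
  · simp [Sw, hf, (h _).1]
  · intro h'
    apply (h (finAddFlip i)).2
    rw [← hf (π _)]
    exact congrArg _ h'

def CL {n p : ℕ} (π : Fin (p + p) → Fin (p + p)) (a : Fin p → Fin n) : Prop :=
  ∀ i j : Fin p, π (Fin.castAdd p i) = Fin.castAdd p j → a i = a j

def CR {n p : ℕ} (π : Fin (p + p) → Fin (p + p)) (a : Fin p → Fin n) : Prop :=
  ∀ i j : Fin p, π (Fin.natAdd p i) = Fin.natAdd p j → a i = a j

lemma compat_iff {n p : ℕ} (π : Fin (p + p) → Fin (p + p)) (h : P π) (a b : Fin p → Fin n) :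
    (∀ i, Fin.append a b (π i) = Fin.append a b i) ↔
      CL π a ∧ CR π b ∧ ∀ i j : Fin p, π (Fin.castAdd p i) = Fin.natAdd p j → a i = b j := by
  constructor
  · intro H
    refine ⟨fun i j e => ?_, fun i j e => ?_, fun i j e => ?_⟩
    · have := H (Fin.castAdd p i)
      rw [e] at this
      simpa [-Fin.natAdd_eq_addNat] using this.symm
    · have := H (Fin.natAdd p i)
      rw [e] at this
      simpa [-Fin.natAdd_eq_addNat] using this.symm
    · have := H (Fin.castAdd p i)
      rw [e] at this
      simpa [-Fin.natAdd_eq_addNat] using this.symm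
  · rintro ⟨h1, h2, h3⟩ i
    have hi : ∃ j, π i = j := ⟨_, rfl⟩
    obtain ⟨j, hj⟩ := hi
    have hj' : π j = i := by rw [← hj, (h i).1]
    rw [hj]
    revert hj hj'
    refine Fin.addCases (fun i => ?_) (fun i => ?_) i <;>
    refine Fin.addCases (fun j => ?_) (fun j => ?_) j <;> intro hj hj' <;>
    simp only [Fin.append_left, Fin.append_right]
    · exact (h1 _ _ hj).symm
    · exact (h3 _ _ hj).symm
    · exact h3 _ _ hj'
    · exact (h2 _ _ hj).symm

lemma compat_L_iff {n p : ℕ} (π : Fin (p + p) → Fin (p + p)) (h : P π) (a b : Fin p → Fin n) :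
    (∀ i, Fin.append a (b ∘ Fin.rev) (L π i) = Fin.append a (b ∘ Fin.rev) i) ↔
      CL π a ∧ CL π b ∧
        ∀ i j : Fin p, π (Fin.castAdd p i) = Fin.natAdd p j → a i = b i := by
  rw [compat_iff _ (P_L π h)]
  have rc : ∀ i : Fin p, (Fin.castAdd p i).rev = Fin.natAdd p i.rev := by
    intro i; ext; simp [Fin.val_rev]; omega
  have rn : ∀ i : Fin p, (Fin.natAdd p i).rev = Fin.castAdd p i.rev := by
    intro i; ext; simp [Fin.val_rev]; omega
  have hl : ∀ i j : Fin p, π (Fin.castAdd p i) = Fin.castAdd p j ↔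
      L π (Fin.castAdd p i) = Fin.castAdd p j := by
    intro i j
    unfold L
    by_cases hh : (π (Fin.castAdd p i)).val < p
    · simp [hh]
    · simp only [Fin.val_castAdd, i.2, if_true, hh, if_false, rc]
      constructor
      · intro e; rw [e] at hh; simp at hh
      · intro e; have := congrArg Fin.val e; simp at this; omega
  have hr : ∀ i j : Fin p, π (Fin.castAdd p i.rev) = Fin.castAdd p j.rev ↔
      L π (Fin.natAdd p i) = Fin.natAdd p j := by
    intro i j
    unfold L
    by_cases hh : (π (Fin.castAdd p i.rev)).val < p
    · simp only [Fin.val_natAdd, rn, hh, if_true, if_false, (show ¬ p + i.val < p by omega)]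
      rw [Fin.rev_eq_iff, rn]
    · simp only [Fin.val_natAdd, rn, hh, if_false, (show ¬ p + i.val < p by omega)]
      constructor
      · intro e; rw [e] at hh; simp only [Fin.val_castAdd] at hh; omega
      · intro e; have := congrArg Fin.val e; simp only [Fin.val_castAdd, Fin.val_natAdd] at this; omega
  have hc : ∀ i j : Fin p, L π (Fin.castAdd p i) = Fin.natAdd p j ↔
      (j = i.rev ∧ ∃ k, π (Fin.castAdd p i) = Fin.natAdd p k) := by
    intro i j
    unfold L
    by_cases hh : (π (Fin.castAdd p i)).val < p
    · simp only [Fin.val_castAdd, i.2, if_true, hh]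
      constructor
      · intro e; rw [e] at hh; simp at hh
      · rintro ⟨_, k, e⟩; rw [e] at hh; simp at hh
    · simp only [Fin.val_castAdd, i.2, if_true, hh, if_false, rc]
      constructor
      · intro e
        refine ⟨?_, ⟨(π (Fin.castAdd p i)).val - p, by omega⟩, ?_⟩
        · have := congrArg Fin.val e; ext; simp only [Fin.val_natAdd] at this; omega
        · ext; simp only [Fin.val_natAdd]; omega
      · rintro ⟨e, _⟩; rw [e]
  refine and_congr ?_ (and_congr ?_ ?_)
  · unfold CL; simp only [hl]
  · unfold CL CR
    simp only [← hr]
    constructor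
    · intro H i j e
      have := H i.rev j.rev (by simpa using e)
      simpa using this
    · intro H i j e
      exact H _ _ e
  · simp only [hc]
    constructor
    · intro H i j e
      have := H i i.rev ⟨rfl, j, e⟩
      simpa using this
    · rintro H i j ⟨rfl, k, e⟩
      simpa using H i k e

lemma prod_rev {d n p : ℕ} (A : Fin n → Matrix (Fin d) (Fin d) ℝ) (hA : ∀ k, (A k).IsSymm)
    (b : Fin p → Fin n) : (List.ofFn fun i => A (b (Fin.rev i))).prod =
      (List.ofFn fun i => A (b i)).prodᵀ := by
  rw [transpose_list_prod]
  congr 1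
  apply List.ext_getElem
  · simp
  · intro k h1 h2
    simp only [List.getElem_ofFn, List.getElem_reverse, List.getElem_map, (hA _).eq]
    congr 2
    ext
    simp [Fin.val_rev]
    omega

lemma prod_append' {d n p : ℕ} (A : Fin n → Matrix (Fin d) (Fin d) ℝ) 
    (a b : Fin p → Fin n) : (List.ofFn fun i => A (Fin.append a b i)).prod =
      (List.ofFn fun i => A (a i)).prod * (List.ofFn fun i => A (b i)).prod := by
  rw [← List.prod_append, ← List.ofFn_fin_append]
  congr 2
  ext1 i
  refine Fin.addCases (fun i => ?_) (fun i => ?_) i <;> simp [-Fin.natAdd_eq_addNat]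

open Classical in
lemma F_L {d n p : ℕ} (A : Fin n → Matrix (Fin d) (Fin d) ℝ) (hA : ∀ k, (A k).IsSymm)
    (π : Fin (p + p) → Fin (p + p)) (h : P π) :
    F A (L π) = ∑ a : Fin p → Fin n, ∑ b : Fin p → Fin n,
      if (CL π a ∧ CL π b ∧ ∀ i j : Fin p, π (Fin.castAdd p i) = Fin.natAdd p j → a i = b i) then
        trace ((List.ofFn fun i => A (a i)).prod * (List.ofFn fun i => A (b i)).prodᵀ) else 0 := by
  rw [← Fintype.sum_prod_type' (f := fun a b : Fin p → Fin n =>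
      if (CL π a ∧ CL π b ∧ ∀ i j : Fin p, π (Fin.castAdd p i) = Fin.natAdd p j → a i = b i) then
        trace ((List.ofFn fun i => A (a i)).prod * (List.ofFn fun i => A (b i)).prodᵀ) else 0)]
  unfold F
  symm
  refine Fintype.sum_equiv (((Equiv.refl _).prodCongr
    (Fin.revPerm.arrowCongr (Equiv.refl _))).trans (Fin.appendEquiv p p)) _ _ fun ⟨a, b⟩ => ?_
  have e : (((Equiv.refl _).prodCongr
    (Fin.revPerm.arrowCongr (Equiv.refl _))).trans (Fin.appendEquiv p p)) (a, b) =
      Fin.append a (b ∘ Fin.rev) := rfl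
  rw [e]
  simp only [compat_L_iff π h, prod_append', Function.comp_apply, prod_rev A hA]

open Classical in
lemma F_eq {d n p : ℕ} (A : Fin n → Matrix (Fin d) (Fin d) ℝ)
    (π : Fin (p + p) → Fin (p + p)) (h : P π) :
    F A π = ∑ a : Fin p → Fin n, ∑ b : Fin p → Fin n,
      if (CL π a ∧ CR π b ∧ ∀ i j : Fin p, π (Fin.castAdd p i) = Fin.natAdd p j → a i = b j) then
        trace ((List.ofFn fun i => A (a i)).prod * (List.ofFn fun i => A (b i)).prod) else 0 := by
  rw [← Fintype.sum_prod_type' (f := fun a b : Fin p → Fin n =>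
      if (CL π a ∧ CR π b ∧ ∀ i j : Fin p, π (Fin.castAdd p i) = Fin.natAdd p j → a i = b j) then
        trace ((List.ofFn fun i => A (a i)).prod * (List.ofFn fun i => A (b i)).prod) else 0)]
  unfold F
  symm
  refine Fintype.sum_equiv (Fin.appendEquiv p p) _ _ fun ⟨a, b⟩ => ?_
  have e : (Fin.appendEquiv p p) (a, b) = Fin.append a b := rfl
  rw [e]
  simp only [compat_iff π h, prod_append']

open Classical in
lemma F_cs {d n p : ℕ} (A : Fin n → Matrix (Fin d) (Fin d) ℝ) (hA : ∀ k, (A k).IsSymm)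
    (π : Fin (p + p) → Fin (p + p)) (h : P π) :
    2 * F A π ≤ F A (L π) + F A (L (Sw π)) := by
  have hf : ∀ i : Fin (p + p), finAddFlip (finAddFlip i) = i := by
    intro i
    refine Fin.addCases (fun i => ?_) (fun i => ?_) i <;> simp [-Fin.natAdd_eq_addNat]
  have hf' : ∀ i j : Fin (p + p), finAddFlip i = j ↔ i = finAddFlip j := by
    intro i j
    constructor
    · rintro rfl; rw [hf]
    · rintro rfl; rw [hf]
  rw [F_L A hA π h, F_L A hA (Sw π) (P_Sw π h), F_eq A π h]
  have hCL : ∀ a : Fin p → Fin n, CL (Sw π) a ↔ CR π a := by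
    intro a
    simp [CL, CR, Sw, hf', -Fin.natAdd_eq_addNat]
  have key := abstract_cs (W := Fin p → Fin p → Option (Fin n))
    (fun a : Fin p → Fin n => if CL π a then (List.ofFn fun i => A (a i)).prod else 0)
    (fun a : Fin p → Fin n => if CR π a then (List.ofFn fun i => A (a i)).prod else 0)
    (fun a i j => if π (Fin.castAdd p i) = Fin.natAdd p j then some (a i) else none)
    (fun b i j => if π (Fin.castAdd p i) = Fin.natAdd p j then some (b j) else none)
  have t1 : ∀ x y : Fin p → Fin p → Fin n,
      ((fun i j => if π (Fin.castAdd p i) = Fin.natAdd p j then some (x i j) else none) =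
      (fun i j => if π (Fin.castAdd p i) = Fin.natAdd p j then some (y i j) else none)) ↔
      ∀ i j, π (Fin.castAdd p i) = Fin.natAdd p j → x i j = y i j := by
    intro x y
    simp only [funext_iff]
    refine forall_congr' fun i => forall_congr' fun j => ?_
    by_cases hh : π (Fin.castAdd p i) = Fin.natAdd p j <;> simp [hh, -Fin.natAdd_eq_addNat]
  have t2 : ∀ b b' : Fin p → Fin n,
      (∀ i j : Fin p, Sw π (Fin.castAdd p i) = Fin.natAdd p j → b i = b' i) ↔
      (∀ i j : Fin p, π (Fin.castAdd p i) = Fin.natAdd p j → b j = b' j) := by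
    intro b b'
    simp only [Sw, hf', finAddFlip_apply_castAdd, finAddFlip_apply_natAdd]
    constructor
    · intro H i j e
      exact H j i (by rw [← e, (h _).1])
    · intro H i j e
      exact H j i (by rw [← e, (h _).1])
  simp only [hCL, t2]
  refine le_trans (le_of_eq ?_) (key.trans (le_of_eq ?_))
  · congr 1
    refine Finset.sum_congr rfl fun a _ => Finset.sum_congr rfl fun b _ => ?_
    simp only [t1 (fun i _ => a i) (fun _ j => b j)]
    by_cases h1 : CL π a <;> by_cases h2 : CR π b <;> simp [h1, h2]
  · congr 1
    · refine Finset.sum_congr rfl fun a _ => Finset.sum_congr rfl fun b _ => ?_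
      simp only [t1 (fun i _ => a i) (fun i _ => b i)]
      by_cases h1 : CL π a <;> by_cases h2 : CL π b <;> simp [h1, h2]
    · refine Finset.sum_congr rfl fun a _ => Finset.sum_congr rfl fun b _ => ?_
      simp only [t1 (fun _ j => a j) (fun _ j => b j)]
      by_cases h1 : CR π a <;> by_cases h2 : CR π b <;> simp [h1, h2]

/-- initial run of adjacent pairs -/
def Run {N : ℕ} (r : ℕ) (π : Fin N → Fin N) : Prop :=
  ∀ i : Fin N, i.val < 2 * r → (π i).val = if i.val % 2 = 0 then i.val + 1 else i.val - 1

lemma val_sub_ite {N : ℕ} (a b : Fin N) :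
    (a - b).val = if b.val ≤ a.val then a.val - b.val else N + a.val - b.val := by
  rw [Fin.val_sub]
  have := a.2
  have := b.2
  split_ifs with h
  · rw [show N - b.val + a.val = (a.val - b.val) + N by omega, Nat.add_mod_right,
      Nat.mod_eq_of_lt (by omega)]
  · rw [Nat.mod_eq_of_lt (by omega)]; omega

lemma claim3 {p r : ℕ} (π : Fin (p + p) → Fin (p + p)) (hr : p ≤ 2 * r) (h : Run r π) :
    Run p (L π) := by
  intro i _
  have h1 := h i
  have h2 := h i.rev
  have hi := i.2
  have e0 : i.rev.val = p + p - 1 - i := by rw [Fin.val_rev]; omega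
  have e2 : (π i.rev).rev.val = p + p - 1 - (π i.rev) := by rw [Fin.val_rev]; omega
  unfold L
  by_cases a : i.val < p
  · have h1 := h1 (by omega)
    simp only [a, if_true]
    split_ifs at * <;> omega
  · have h2 := h2 (by omega)
    simp only [a, if_false]
    split_ifs at * <;> omega

lemma claim2 {p r : ℕ} [NeZero (p + p)] (π : Fin (p + p) → Fin (p + p)) (hr : 2 * r ≤ p)
    (hr0 : 1 ≤ r) (h : Run r π) :
    Run (2 * r) (rot ⟨2 * r, by omega⟩ (L π)) := by
  intro i hi
  unfold rot
  set c : Fin (p + p) := ⟨2 * r, by omega⟩ with hc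
  have hcv : c.val = 2 * r := rfl
  have hk := val_sub_ite i c
  set k := i - c
  have hi2 := i.2
  have h1 := h k
  have h2 := h k.rev
  have e0 : k.rev.val = p + p - 1 - k := by rw [Fin.val_rev]; omega
  have e2 : (π k.rev).rev.val = p + p - 1 - (π k.rev) := by rw [Fin.val_rev]; omega
  rw [Fin.val_add_eq_ite, hcv]
  rw [hcv] at hk
  unfold L
  by_cases a : i.val < 2 * r
  · rw [if_neg (by omega)] at hk
    have h2 := h2 (by omega)
    have : ¬ k.val < p := by omega
    simp only [this, if_false]
    clear h1
    have hlt : (π k.rev).val < p := by split_ifs at h2 <;> omega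
    simp only [hlt, if_true, e2]
    split_ifs at * <;> omega
  · rw [if_pos (by omega)] at hk
    have h1 := h1 (by omega)
    have : k.val < p := by omega
    clear h2
    have hlt : (π k).val < p := by split_ifs at h1 <;> omega
    simp only [this, if_true, hlt]
    split_ifs at * <;> omega

lemma run_one {p : ℕ} [NeZero (p + p)] (π : Fin (p + p) → Fin (p + p)) (h : P π)
    (k l : Fin (p + p)) (hkl : l.val = k.val + 1 ∨ (k.val + 1 = p + p ∧ l.val = 0)) (e : π k = l) :
    Run 1 (rot (-k) π) := by
  have e' : π l = k := by rw [← e, (h k).1]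
  have hlk := val_sub_ite l k
  have hk := k.2
  have hl := l.2
  have hp : p ≠ 0 := by omega
  have hv : (l - k).val = 1 := by rw [hlk]; split_ifs <;> omega
  intro i hi
  have hi' : i.val = 0 ∨ i.val = 1 := by omega
  rcases hi' with h0 | h0
  · have : i = 0 := Fin.ext (by simp [h0])
    subst this
    simp [rot, e, ← sub_eq_add_neg, hv]
  · have : i = l - k := Fin.ext (by omega)
    simp [rot, this, e', hv]

lemma pow_sum' {d n : ℕ} (B : Fin n → Matrix (Fin d) (Fin d) ℝ) (p : ℕ) :
    ∑ v : Fin p → Fin n, (List.ofFn fun i => B (v i)).prod = (∑ k, B k) ^ p := by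
  induction p with
  | zero => simp
  | succ p ih =>
    rw [pow_succ', ← ih, Finset.sum_mul_sum, ← Fintype.sum_prod_type'
      (f := fun k (v : Fin p → Fin n) => B k * (List.ofFn fun i => B (v i)).prod)]
    symm
    refine Fintype.sum_equiv (Fin.consEquiv (fun _ => Fin n)) _ _ fun ⟨k, v⟩ => ?_
    simp [Fin.consEquiv, List.ofFn_succ]

lemma F_run {d n p : ℕ} (A : Fin n → Matrix (Fin d) (Fin d) ℝ) {N : ℕ} (hN : N = 2 * p)
    (π : Fin N → Fin N) (h : Run p π) : F A π = trace ((∑ k, A k ^ 2) ^ p) := by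
  subst hN
  rw [← pow_sum', trace_sum]
  unfold F
  rw [← Finset.sum_filter]
  symm
  refine Finset.sum_bij' (fun v _ => fun i => v ⟨i.val / 2, by omega⟩)
    (fun u _ => fun j => u ⟨2 * j.val, by omega⟩) ?_ ?_ ?_ ?_ ?_
  · intro v _
    simp only [Finset.mem_filter, Finset.mem_univ, true_and]
    intro i
    congr 1
    ext
    have := h i i.2
    simp only
    split_ifs at this <;> omega
  · simp
  · intro v _
    ext j
    simp
  · intro u hu
    simp only [Finset.mem_filter, Finset.mem_univ, true_and] at hu
    ext i
    simp only
    rcases Nat.mod_two_eq_zero_or_one i.val with hi | hi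
    · congr 2; ext; simp only; omega
    · rw [← hu i]
      congr 2; ext
      rw [h i i.2, if_neg (by omega)]
      simp only; omega
  · intro v _
    rw [List.ofFn_mul', List.prod_flatten, List.map_ofFn]
    congr 3
    ext1 j
    have : (2 * j.val + 1) / 2 = j.val := by omega
    simp [List.ofFn_succ, pow_two, this]

set_option maxHeartbeats 1000000 in
lemma main {d n p : ℕ} (A : Fin n → Matrix (Fin d) (Fin d) ℝ) (hA : ∀ k, (A k).IsSymm)
    {N : ℕ} (hN : N = p + p) (π : Fin N → Fin N) (h : P π) :
    F A π ≤ trace ((∑ k, A k ^ 2) ^ p) := by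
  subst hN
  rcases Nat.eq_zero_or_pos p with hp | hp
  · exact (F_run A (by omega) π (by intro i; have := i.2; omega)).le
  haveI : NeZero (p + p) := ⟨by omega⟩
  obtain ⟨σ, hσ, hmax⟩ := Set.exists_max_image {π : Fin (p + p) → Fin (p + p) | P π} (F A)
    (Set.toFinite _) ⟨π, h⟩
  simp only [Set.mem_ofPred_eq] at hσ hmax
  refine (hmax π h).trans ?_
  have hL : ∀ τ : Fin (p + p) → Fin (p + p), P τ → F A τ = F A σ → F A (L τ) = F A σ := by
    intro τ hτ e
    have h1 := F_cs A hA τ hτ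
    have h2 := hmax _ (P_L _ hτ)
    have h3 := hmax _ (P_L _ (P_Sw _ hτ))
    linarith
  have c1 : ∃ τ : Fin (p + p) → Fin (p + p), P τ ∧ F A τ = F A σ ∧ Run 1 τ := by
    -- find a maximizer with an adjacent pair
    by_cases hz : (σ 0).val < p
    · set c : Fin (p + p) := ⟨p - 1, by omega⟩ with hc
      have hcv : c.val = p - 1 := rfl
      have hP := P_rot c σ hσ
      have hF := F_rot A c σ
      have h0 : (σ 0).val ≠ 0 := fun e => (hσ 0).2 (Fin.ext (by simpa using e))
      have hr : (rot c σ c).val = (σ 0).val + (p - 1) := by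
        simp only [rot, sub_self, Fin.val_add_eq_ite, hcv]
        rw [if_neg (by omega)]
      refine ⟨_, P_rot _ _ (P_L _ hP), (F_rot A _ _).trans (hL _ hP hF),
        run_one _ (P_L _ hP) c c.rev ?_ ?_⟩
      · left; rw [Fin.val_rev]; omega
      · unfold L
        rw [if_pos (by omega), if_neg (by omega)]
    · refine ⟨_, P_rot _ _ (P_L _ hσ), (F_rot A _ _).trans (hL _ hσ rfl),
        run_one _ (P_L _ hσ) (Fin.rev 0) 0 ?_ ?_⟩
      · right; rw [Fin.val_rev]; simp; omega
      · have := (P_L _ hσ 0).1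
        have e : L σ 0 = Fin.rev 0 := by
          unfold L
          rw [if_pos (by simpa using hp), if_neg hz]
        rwa [e] at this
  have c2 : ∀ k, ∃ τ : Fin (p + p) → Fin (p + p), P τ ∧ F A τ = F A σ ∧ Run (min (k + 1) p) τ := by
    intro k
    induction k with
    | zero =>
      obtain ⟨τ, h1, h2, h3⟩ := c1
      exact ⟨τ, h1, h2, fun i hi => h3 i (by omega)⟩
    | succ k ih =>
      obtain ⟨τ, h1, h2, h3⟩ := ih
      obtain ⟨r, hr⟩ : ∃ r, r = min (k + 1) p := ⟨_, rfl⟩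
      rw [← hr] at h3
      have hr1 : 1 ≤ r := by omega
      by_cases hk : 2 * r ≤ p
      · have hm : min (k + 1 + 1) p ≤ 2 * r := by omega
        have h4 := claim2 τ hk hr1 h3
        refine ⟨_, P_rot _ _ (P_L _ h1), (F_rot A _ _).trans (hL _ h1 h2), fun i hi => h4 i ?_⟩
        omega
      · have h4 := claim3 τ (by omega) h3
        refine ⟨_, P_L _ h1, hL _ h1 h2, fun i hi => h4 i ?_⟩
        omega
  obtain ⟨τ, h1, h2, h3⟩ := c2 p
  rw [← h2]
  refine (F_run A (by omega) τ ?_).le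
  rwa [min_eq_right (by omega)] at h3

end Buch

/-- **Buchholz's "commutative is the worst case" lemma.** For symmetric `d×d` real matrices
`A 1, …, A n` and any pair partition of `[2p]` (encoded as a fixed-point-free involution `π`
of `Fin (2*p)`), the sum over all `u : [2p] → [n]` compatible with `π` of
`Tr(A_{u 1} ⋯ A_{u 2p})` is at most `Tr((∑ k, (A k)²)^p)`. -/
theorem buchholz_commutative_worst_case
    (d n p : ℕ) (A : Fin n → Matrix (Fin d) (Fin d) ℝ)
    (hA : ∀ k, (A k).IsSymm)
    (π : Equiv.Perm (Fin (2 * p)))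
    (hinv : ∀ i, π (π i) = i) (hfpf : ∀ i, π i ≠ i) :
    ∑ u ∈ Finset.univ.filter (fun u : Fin (2 * p) → Fin n => ∀ i, u (π i) = u i),
        Matrix.trace (List.ofFn (fun i => A (u i))).prod
      ≤ Matrix.trace ((∑ k, A k ^ 2) ^ p) := by
  have := Buch.main A hA (two_mul p) (fun i => π i) (fun i => ⟨hinv i, hfpf i⟩)
  rw [Finset.sum_filter]
  exact this
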